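/- Let U = (T, G, H) be an itKI_c1-algebra and let S be a tense 1-filter of C(U). Then D_S := {u ∈ T : ∼u⇒c ∈ S and ⊤⇒(u⊔c) ∈ S} is a tense deductive system of U satisfying D_S ∩ C(T) = S; furthermore, D_S is a centered tense deductive system of U. -/

import Mathlib

/-- A tense KI-algebra: a centered Kleene algebra with an implication ⇒
satisfying (KI1)-(KI5), together with tense operators G, H satisfying
(t1)-(t6), where F x := ∼G(∼x) and P x := ∼H(∼x). -/
structure TenseKI (T : Type*) [DistribLattice T] [BoundedOrder T] where
  neg : T → T
  c : T
  imp : T → T → T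
  neg_neg : ∀ x : T, neg (neg x) = x
  neg_sup : ∀ x y : T, neg (x ⊔ y) = neg x ⊓ neg y
  kleene : ∀ x y : T, x ⊓ neg x ≤ y ⊔ neg y
  neg_c : neg c = c
  KI1a : ∀ x y z : T, imp x y ⊓ imp x z = imp x (y ⊓ z)
  KI1b : ∀ x y z : T, imp x z ⊓ imp y z = imp (x ⊔ y) z
  KI1c : ∀ x : T, imp ⊥ x = ⊤
  KI1d : ∀ x : T, imp x ⊤ = ⊤
  KI2 : ∀ x y : T, (x ⊓ imp x y) ⊔ c ≤ y ⊔ c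
  KI3 : imp c c = ⊤
  KI4 : ∀ x y : T, imp x y ⊓ c = (neg x ⊔ y) ⊓ c
  KI5 : ∀ x y : T, imp x (neg y) ⊔ c = imp x (neg y ⊔ c) ⊓ imp y (neg x ⊔ c)
  G : T → T
  H : T → T
  t1G : G ⊤ = ⊤
  t1H : H ⊤ = ⊤
  t2G : ∀ x y : T, G (x ⊓ y) = G x ⊓ G y
  t2H : ∀ x y : T, H (x ⊓ y) = H x ⊓ H y
  t3G : ∀ x : T, x ≤ G (neg (H (neg x)))
  t3H : ∀ x : T, x ≤ H (neg (G (neg x)))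
  t4G : ∀ x y : T, G (x ⊔ y) ≤ G x ⊔ neg (G (neg y))
  t4H : ∀ x y : T, H (x ⊔ y) ≤ H x ⊔ neg (H (neg y))
  t5G : ∀ x y : T, G (imp x y) ≤ imp (G x) (G y)
  t5H : ∀ x y : T, H (imp x y) ≤ imp (H x) (H y)
  t6G : ∀ x y : T, G (imp x y) ≤ imp (neg (G (neg x))) (neg (G (neg y)))
  t6H : ∀ x y : T, H (imp x y) ≤ imp (neg (H (neg x))) (neg (H (neg y)))

/-- F x := ∼G(∼x). -/
def TenseKI.F {T : Type*} [DistribLattice T] [BoundedOrder T] (K : TenseKI T) (x : T) : T :=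
  K.neg (K.G (K.neg x))

/-- P x := ∼H(∼x). -/
def TenseKI.P {T : Type*} [DistribLattice T] [BoundedOrder T] (K : TenseKI T) (x : T) : T :=
  K.neg (K.H (K.neg x))

/-- An itKI_c1-algebra: a tense centered KI-algebra satisfying x ⇒ x = ⊤
and the interpolation condition (CK). -/
structure ItKIc1 (T : Type*) [DistribLattice T] [BoundedOrder T] extends TenseKI T where
  Gc : G c = c
  Hc : H c = c
  imp_self : ∀ x : T, imp x x = ⊤
  CK : ∀ x y : T, c ≤ x → c ≤ y → x ⊓ y ≤ c → ∃ z : T, z ⊔ c = x ∧ neg z ⊔ c = y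

section
variable {T : Type*} [DistribLattice T] [BoundedOrder T]

/-- F on an itKI_c1-algebra. -/
abbrev ItKIc1.F (K : ItKIc1 T) : T → T := K.toTenseKI.F

/-- P on an itKI_c1-algebra. -/
abbrev ItKIc1.P (K : ItKIc1 T) : T → T := K.toTenseKI.P

/-- A congruence of an itKI_c1-algebra: an equivalence relation compatible
with ⊓, ⊔, ⇒, ∼, G, H. -/
def ItKIc1.IsCongrU (K : ItKIc1 T) (ε : T → T → Prop) : Prop :=
  Equivalence ε ∧
  (∀ a b x y : T, ε a b → ε x y →
    ε (a ⊓ x) (b ⊓ y) ∧ ε (a ⊔ x) (b ⊔ y) ∧ ε (K.imp a x) (K.imp b y)) ∧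
  (∀ a b : T, ε a b → ε (K.neg a) (K.neg b) ∧ ε (K.G a) (K.G b) ∧ ε (K.H a) (K.H b))

/-- A tense 1-filter of C(U): a lattice filter S of C(T) = {x : c ≤ x} with
((a⊓f)⇒b)⇒(a⇒b) ∈ S for all a, b ∈ C(T), f ∈ S, closed under G and H. -/
def ItKIc1.IsTense1FilterC (K : ItKIc1 T) (S : Set T) : Prop :=
  (∀ x ∈ S, K.c ≤ x) ∧ S.Nonempty ∧
  (∀ x ∈ S, ∀ y : T, K.c ≤ y → x ≤ y → y ∈ S) ∧
  (∀ x ∈ S, ∀ y ∈ S, x ⊓ y ∈ S) ∧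
  (∀ a b : T, K.c ≤ a → K.c ≤ b → ∀ f ∈ S,
    K.imp (K.imp (a ⊓ f) b) (K.imp a b) ∈ S) ∧
  (∀ x ∈ S, K.G x ∈ S) ∧ (∀ x ∈ S, K.H x ∈ S)

/-- A tense deductive system of U: contains ⊤, closed under modus ponens
and under G and H. -/
def ItKIc1.IsTDS (K : ItKIc1 T) (D : Set T) : Prop :=
  ⊤ ∈ D ∧ (∀ u ∈ D, ∀ v : T, K.imp u v ∈ D → v ∈ D) ∧
  (∀ u ∈ D, K.G u ∈ D ∧ K.H u ∈ D)

/-- A centered tense deductive system: a tense deductive system D such that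
(ctD1) D ∩ C(T) is a tense 1-filter of C(U) and (ctD2) ∼u⇒c ∈ D and
⊤⇒(u⊔c) ∈ D imply u ∈ D. -/
def ItKIc1.IsCTDS (K : ItKIc1 T) (D : Set T) : Prop :=
  K.IsTDS D ∧ K.IsTense1FilterC (D ∩ {x | K.c ≤ x}) ∧
  (∀ u : T, K.imp (K.neg u) K.c ∈ D → K.imp ⊤ (u ⊔ K.c) ∈ D → u ∈ D)

end

section
variable {T : Type*} [DistribLattice T] [BoundedOrder T]

namespace TenseKI

variable (K : TenseKI T)

theorem neg_inf (x y : T) : K.neg (x ⊓ y) = K.neg x ⊔ K.neg y := by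
  rw [← K.neg_neg (K.neg x ⊔ K.neg y), K.neg_sup, K.neg_neg, K.neg_neg]

theorem neg_anti {x y : T} (h : x ≤ y) : K.neg y ≤ K.neg x := by
  rw [← sup_eq_right.mpr h, K.neg_sup]
  exact inf_le_left

theorem imp_mono (x : T) {y z : T} (h : y ≤ z) : K.imp x y ≤ K.imp x z := by
  rw [← inf_eq_left.mpr h, ← K.KI1a]
  exact inf_le_right

theorem imp_anti {x y : T} (z : T) (h : x ≤ y) : K.imp y z ≤ K.imp x z := by
  rw [← sup_eq_right.mpr h, ← K.KI1b]
  exact inf_le_left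

theorem c_le_imp (x : T) {y : T} (h : K.c ≤ y) : K.c ≤ K.imp x y := by
  rw [← inf_eq_right, K.KI4, inf_eq_right]
  exact h.trans le_sup_right

theorem imp_eq_top_of_le_c {x y : T} (hx : x ≤ K.c) (hy : K.c ≤ y) : K.imp x y = ⊤ :=
  top_le_iff.mp <| K.KI3.ge.trans <| (K.imp_anti K.c hx).trans (K.imp_mono x hy)

theorem sup_c_imp (x : T) {y : T} (h : K.c ≤ y) : K.imp (x ⊔ K.c) y = K.imp x y := by
  rw [← K.KI1b, K.imp_eq_top_of_le_c le_rfl h, inf_top_eq]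

theorem inf_imp_le (x : T) {y : T} (h : K.c ≤ y) : x ⊓ K.imp x y ≤ y :=
  le_sup_left.trans <| (K.KI2 x y).trans (sup_le le_rfl h)

theorem imp_sup_c (x y : T) :
    K.imp x y ⊔ K.c = K.imp x (y ⊔ K.c) ⊓ K.imp (K.neg y) (K.neg x ⊔ K.c) := by
  simpa only [K.neg_neg] using K.KI5 x (K.neg y)

theorem neg_imp_sup_c (x y : T) : K.neg (K.imp x y) ⊔ K.c = (x ⊓ K.neg y) ⊔ K.c := by
  simpa only [K.neg_inf, K.neg_sup, K.neg_neg, K.neg_c] using congrArg K.neg (K.KI4 x y)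

end TenseKI

namespace ItKIc1

variable (K : ItKIc1 T) {S : Set T}

/-- The set `D_S` attached to a subset `S` of `C(U)`. -/
def deductiveSet (S : Set T) : Set T :=
  {u : T | K.imp (K.neg u) K.c ∈ S ∧ K.imp ⊤ (u ⊔ K.c) ∈ S}

variable {K}

namespace IsTense1FilterC

theorem mem_of_le (hS : K.IsTense1FilterC S) {x y : T} (hx : x ∈ S) (h : x ≤ y) : y ∈ S :=
  hS.2.2.1 x hx y ((hS.1 x hx).trans h) h

theorem top_mem (hS : K.IsTense1FilterC S) : ⊤ ∈ S :=
  let ⟨_, hx⟩ := hS.2.1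
  hS.mem_of_le hx le_top

theorem mem_of_imp_mem (hS : K.IsTense1FilterC S) {x y : T} (hy : K.c ≤ y) (hx : x ∈ S)
    (h : K.imp x y ∈ S) : y ∈ S :=
  hS.mem_of_le (hS.2.2.2.1 x hx _ h) (K.inf_imp_le x hy)

theorem imp_mem_of_inf_imp_mem (hS : K.IsTense1FilterC S) {a b f : T} (ha : K.c ≤ a)
    (hb : K.c ≤ b) (hf : f ∈ S) (h : K.imp (a ⊓ f) b ∈ S) : K.imp a b ∈ S :=
  hS.mem_of_imp_mem (K.c_le_imp a hb) h (hS.2.2.2.2.1 a b ha hb f hf)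

theorem top_imp_mem_iff (hS : K.IsTense1FilterC S) {x : T} (hx : K.c ≤ x) :
    K.imp ⊤ x ∈ S ↔ x ∈ S := by
  refine ⟨hS.mem_of_imp_mem hx hS.top_mem, fun h => ?_⟩
  refine hS.imp_mem_of_inf_imp_mem le_top hx h ?_
  rw [top_inf_eq, K.imp_self]
  exact hS.top_mem

theorem mem_deductiveSet_iff (hS : K.IsTense1FilterC S) {u : T} :
    u ∈ K.deductiveSet S ↔ K.imp (K.neg u) K.c ∈ S ∧ u ⊔ K.c ∈ S :=
  and_congr_right fun _ => hS.top_imp_mem_iff le_sup_right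

theorem mem_deductiveSet_iff_of_c_le (hS : K.IsTense1FilterC S) {u : T} (hu : K.c ≤ u) :
    u ∈ K.deductiveSet S ↔ u ∈ S := by
  have h : K.neg u ≤ K.c := (K.neg_anti hu).trans K.neg_c.le
  rw [hS.mem_deductiveSet_iff, K.imp_eq_top_of_le_c h le_rfl, sup_eq_left.mpr hu,
    and_iff_right hS.top_mem]

theorem deductiveSet_inter (hS : K.IsTense1FilterC S) :
    K.deductiveSet S ∩ {x | K.c ≤ x} = S := by
  ext u
  exact ⟨fun h => (hS.mem_deductiveSet_iff_of_c_le h.2).mp h.1,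
    fun h => ⟨(hS.mem_deductiveSet_iff_of_c_le (hS.1 u h)).mpr h, hS.1 u h⟩⟩

theorem mem_deductiveSet_of_imp_mem (hS : K.IsTense1FilterC S) {u v : T}
    (hu : u ∈ K.deductiveSet S) (huv : K.imp u v ∈ K.deductiveSet S) :
    v ∈ K.deductiveSet S := by
  rw [hS.mem_deductiveSet_iff] at hu huv ⊢
  obtain ⟨h₁, h₂⟩ := huv
  rw [← K.sup_c_imp _ le_rfl, K.neg_imp_sup_c] at h₁
  rw [K.imp_sup_c] at h₂
  constructor
  · rw [← K.sup_c_imp _ le_rfl]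
    refine hS.imp_mem_of_inf_imp_mem le_sup_right le_rfl hu.2 ?_
    rwa [← sup_inf_right, inf_comm (K.neg v) u]
  · refine hS.mem_of_imp_mem le_sup_right hu.2 ?_
    rw [K.sup_c_imp _ le_sup_right]
    exact hS.mem_of_le h₂ inf_le_left

theorem G_mem_deductiveSet (hS : K.IsTense1FilterC S) {u : T} (hu : u ∈ K.deductiveSet S) :
    K.G u ∈ K.deductiveSet S := by
  rw [hS.mem_deductiveSet_iff] at hu ⊢
  have h₁ := K.t6G (K.neg u) K.c
  have h₂ := K.t4G u K.c
  simp only [K.neg_neg, K.neg_c, K.Gc] at h₁ h₂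
  exact ⟨hS.mem_of_le (hS.2.2.2.2.2.1 _ hu.1) h₁, hS.mem_of_le (hS.2.2.2.2.2.1 _ hu.2) h₂⟩

theorem H_mem_deductiveSet (hS : K.IsTense1FilterC S) {u : T} (hu : u ∈ K.deductiveSet S) :
    K.H u ∈ K.deductiveSet S := by
  rw [hS.mem_deductiveSet_iff] at hu ⊢
  have h₁ := K.t6H (K.neg u) K.c
  have h₂ := K.t4H u K.c
  simp only [K.neg_neg, K.neg_c, K.Hc] at h₁ h₂
  exact ⟨hS.mem_of_le (hS.2.2.2.2.2.2 _ hu.1) h₁, hS.mem_of_le (hS.2.2.2.2.2.2 _ hu.2) h₂⟩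

theorem isTDS_deductiveSet (hS : K.IsTense1FilterC S) : K.IsTDS (K.deductiveSet S) :=
  ⟨(hS.mem_deductiveSet_iff_of_c_le le_top).mpr hS.top_mem,
    fun _ hu _ huv => hS.mem_deductiveSet_of_imp_mem hu huv,
    fun _ hu => ⟨hS.G_mem_deductiveSet hu, hS.H_mem_deductiveSet hu⟩⟩

theorem isCTDS_deductiveSet (hS : K.IsTense1FilterC S) : K.IsCTDS (K.deductiveSet S) := by
  refine ⟨hS.isTDS_deductiveSet, hS.deductiveSet_inter.symm ▸ hS, fun u h₁ h₂ => ⟨?_, ?_⟩⟩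
  · exact (hS.mem_deductiveSet_iff_of_c_le (K.c_le_imp _ le_rfl)).mp h₁
  · exact (hS.mem_deductiveSet_iff_of_c_le (K.c_le_imp _ le_sup_right)).mp h₂

end IsTense1FilterC

end ItKIc1

end

/-- For a tense 1-filter S of C(U), the set
D_S = {u : ∼u⇒c ∈ S and ⊤⇒(u⊔c) ∈ S} is a tense deductive system of U with
D_S ∩ C(T) = S; furthermore, D_S is a centered tense deductive system of U. -/
theorem stmt15 {T : Type*} [DistribLattice T] [BoundedOrder T] (K : ItKIc1 T)
    (S : Set T) (hS : K.IsTense1FilterC S) :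
    K.IsTDS {u : T | K.imp (K.neg u) K.c ∈ S ∧ K.imp ⊤ (u ⊔ K.c) ∈ S} ∧
    {u : T | K.imp (K.neg u) K.c ∈ S ∧ K.imp ⊤ (u ⊔ K.c) ∈ S} ∩ {x | K.c ≤ x} = S ∧
    K.IsCTDS {u : T | K.imp (K.neg u) K.c ∈ S ∧ K.imp ⊤ (u ⊔ K.c) ∈ S} := by
  exact ⟨hS.isTDS_deductiveSet, hS.deductiveSet_inter, hS.isCTDS_deductiveSet⟩
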